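/- Let α₁, α₂ ∈ ℂ and let ψ, ψ̃ be entire functions with ψ, ψ̃ ∈ F^{α₁,α₂}_m ∩ Q and ψ not identically zero. Then the quotient ψ̃/ψ is an even elliptic function; equivalently, ψ̃(z)·ψ(−z) = ψ̃(−z)·ψ(z) for all z ∈ ℂ. -/

import Mathlib

open Filter Topology

/-- Membership in the space `Q` of entire functions satisfying the Bethe-type conditions
at all points `ω ∈ ω_s + 2Γ` (with `η(ω) = n₁η₁ + n₂η₂` for `ω = n₁ω₁ + n₂ω₂ ∈ Γ`,
so that `η(ω_s + 2(n₁ω₁ + n₂ω₂)) = η_s + 2(n₁η₁ + n₂η₂)`). -/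
def memQ (ω η : Fin 4 → ℂ) (ω1 ω2 η1 η2 γ : ℂ) (m : ℕ) (mi mi' : Fin 4 → ℕ)
    (ψ : ℂ → ℂ) : Prop :=
  Differentiable ℂ ψ ∧
  ∀ s : Fin 4, ∀ n1 n2 : ℤ,
    (∀ j : ℕ, 1 ≤ j → j ≤ mi s →
      ψ (ω s + 2 * ((n1 : ℂ) * ω1 + (n2 : ℂ) * ω2) + 2 * (j : ℂ) * γ) =
        ψ (ω s + 2 * ((n1 : ℂ) * ω1 + (n2 : ℂ) * ω2) - 2 * (j : ℂ) * γ) *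
          Complex.exp (4 * (j : ℂ) * γ * (m : ℂ) *
            (η s + 2 * ((n1 : ℂ) * η1 + (n2 : ℂ) * η2)))) ∧
    (∀ j : ℕ, 1 ≤ j → j ≤ mi' s →
      ψ (ω s + 2 * ((n1 : ℂ) * ω1 + (n2 : ℂ) * ω2) + (2 * (j : ℂ) - 1) * γ) =
        ψ (ω s + 2 * ((n1 : ℂ) * ω1 + (n2 : ℂ) * ω2) - (2 * (j : ℂ) - 1) * γ) *
          Complex.exp ((4 * (j : ℂ) - 2) * γ * (m : ℂ) *
            (η s + 2 * ((n1 : ℂ) * η1 + (n2 : ℂ) * η2))))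

/-- The `q`-Pochhammer symbol `(w; q)_∞ = ∏ₙ (1 - qⁿ w)`. -/
noncomputable def qPochhammerInf (q w : ℂ) : ℂ := ∏' n : ℕ, (1 + -(q ^ n * w))

lemma summable_norm_neg_pow_mul {q : ℂ} (hq : ‖q‖ < 1) (w : ℂ) :
    Summable fun n : ℕ ↦ ‖-(q ^ n * w)‖ := by
  simpa using (summable_geometric_of_lt_one (norm_nonneg q) hq).mul_right ‖w‖

lemma qPochhammerInf_eq_mul {q : ℂ} (hq : ‖q‖ < 1) (w : ℂ) :
    qPochhammerInf q w = (1 - w) * qPochhammerInf q (q * w) := by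
  have hs := (summable_nat_add_iff (f := fun n : ℕ ↦ ‖-(q ^ n * w)‖) 1).2
    (summable_norm_neg_pow_mul hq w)
  have h := tprod_eq_zero_mul' (f := fun n : ℕ ↦ 1 + -(q ^ n * w))
    (multipliable_one_add_of_summable (f := fun n : ℕ ↦ -(q ^ (n + 1) * w)) hs)
  have h0 : 1 + -(q ^ 0 * w) = 1 - w := by ring
  have h1 : ∀ n : ℕ, 1 + -(q ^ (n + 1) * w) = 1 + -(q ^ n * (q * w)) := fun n ↦ by ring
  simp only [h0, h1] at h
  exact h

lemma qPochhammerInf_ne_zero {q w : ℂ} (hq : ‖q‖ < 1) (hw : ‖w‖ < 1) :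
    qPochhammerInf q w ≠ 0 := by
  refine tprod_one_add_ne_zero_of_summable (fun n h ↦ ?_) (summable_norm_neg_pow_mul hq w)
  have h1 : q ^ n * w = 1 := by linear_combination -h
  have h2 : ‖q ^ n * w‖ < 1 := by
    rw [norm_mul, norm_pow]
    exact mul_lt_one_of_nonneg_of_lt_one_right (pow_le_one₀ (norm_nonneg q) hq.le)
      (norm_nonneg w) hw
  simp [h1] at h2

lemma differentiable_qPochhammerInf {q : ℂ} (hq : ‖q‖ < 1) :
    Differentiable ℂ (qPochhammerInf q) := by
  intro w
  have hw : w ∈ Metric.ball (0 : ℂ) (‖w‖ + 1) := by simp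
  have h := ((summable_geometric_of_lt_one (norm_nonneg q) hq).mul_right
    (‖w‖ + 1)).hasProdLocallyUniformlyOn_nat_one_add (f := fun n w ↦ -(q ^ n * w))
    (K := Metric.ball (0 : ℂ) (‖w‖ + 1)) Metric.isOpen_ball
    (Eventually.of_forall fun n x hx ↦ by
      rw [norm_neg, norm_mul, norm_pow]
      gcongr
      exact (mem_ball_zero_iff.1 hx).le)
    (fun n ↦ by fun_prop)
  exact (h.differentiableOn (Eventually.of_forall fun s ↦ by
    simpa [Finset.prod_fn] using DifferentiableOn.finsetProd (fun _ _ ↦ by fun_prop))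
    Metric.isOpen_ball).differentiableAt (Metric.isOpen_ball.mem_nhds hw)

/-- The additive character `z ↦ exp (2πiz)`. -/
noncomputable def expTwoPi (z : ℂ) : ℂ := Complex.exp (2 * Real.pi * Complex.I * z)

lemma expTwoPi_add (z w : ℂ) : expTwoPi (z + w) = expTwoPi z * expTwoPi w := by
  simp [expTwoPi, mul_add, Complex.exp_add]

lemma expTwoPi_ne_zero (z : ℂ) : expTwoPi z ≠ 0 := Complex.exp_ne_zero _

lemma expTwoPi_neg (z : ℂ) : expTwoPi (-z) = (expTwoPi z)⁻¹ := by
  simp [expTwoPi, Complex.exp_neg]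

lemma expTwoPi_one : expTwoPi 1 = 1 := by simp [expTwoPi, Complex.exp_two_pi_mul_I]

lemma expTwoPi_eq_one_iff (z : ℂ) : expTwoPi z = 1 ↔ ∃ n : ℤ, z = n := by
  rw [expTwoPi, Complex.exp_eq_one_iff]
  refine exists_congr fun n ↦ ?_
  rw [mul_comm (n : ℂ)]
  exact mul_right_inj' Complex.two_pi_I_ne_zero

lemma norm_expTwoPi (z : ℂ) : ‖expTwoPi z‖ = Real.exp (-(2 * Real.pi * z.im)) := by
  simp [expTwoPi, Complex.norm_exp]

lemma differentiable_expTwoPi : Differentiable ℂ expTwoPi := by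
  unfold expTwoPi; fun_prop

lemma norm_expTwoPi_lt_one {τ : ℂ} (hτ : 0 < τ.im) : ‖expTwoPi τ‖ < 1 := by
  rw [norm_expTwoPi, Real.exp_lt_one_iff]
  have := Real.pi_pos
  nlinarith [mul_pos this hτ]

/-- The theta function of order one with simple zeros exactly on `ℤ + ℤτ`, as a product. -/
noncomputable def thetaProd (τ z : ℂ) : ℂ :=
  qPochhammerInf (expTwoPi τ) (expTwoPi z) *
    qPochhammerInf (expTwoPi τ) (expTwoPi τ * expTwoPi (-z))

lemma differentiable_thetaProd {τ : ℂ} (hτ : 0 < τ.im) : Differentiable ℂ (thetaProd τ) := by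
  have h := differentiable_qPochhammerInf (norm_expTwoPi_lt_one hτ)
  have he := differentiable_expTwoPi
  unfold thetaProd
  exact (h.comp he).mul (h.comp ((he.comp differentiable_neg).const_mul _))

lemma thetaProd_add_one (τ z : ℂ) : thetaProd τ (z + 1) = thetaProd τ z := by
  have h : expTwoPi (z + 1) = expTwoPi z := by rw [expTwoPi_add, expTwoPi_one, mul_one]
  simp only [thetaProd, expTwoPi_neg, h]

lemma thetaProd_eq_one_sub_mul {τ : ℂ} (hτ : 0 < τ.im) (z : ℂ) :
    thetaProd τ z = (1 - expTwoPi z) * (qPochhammerInf (expTwoPi τ) (expTwoPi τ * expTwoPi z) *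
      qPochhammerInf (expTwoPi τ) (expTwoPi τ * expTwoPi (-z))) := by
  rw [thetaProd, qPochhammerInf_eq_mul (norm_expTwoPi_lt_one hτ) (expTwoPi z), mul_assoc]

lemma thetaProd_add_tau {τ : ℂ} (hτ : 0 < τ.im) (z : ℂ) :
    thetaProd τ (z + τ) = -expTwoPi (-z) * thetaProd τ z := by
  have h1 : expTwoPi τ * expTwoPi (-(z + τ)) = expTwoPi (-z) := by
    rw [← expTwoPi_add]; congr 1; ring
  rw [thetaProd_eq_one_sub_mul hτ z, thetaProd, h1,
    qPochhammerInf_eq_mul (norm_expTwoPi_lt_one hτ) (expTwoPi (-z)), expTwoPi_add,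
    mul_comm (expTwoPi z) (expTwoPi τ)]
  have h2 : expTwoPi (-z) * expTwoPi z = 1 := by
    rw [expTwoPi_neg, inv_mul_cancel₀ (expTwoPi_ne_zero z)]
  linear_combination (-(qPochhammerInf (expTwoPi τ) (expTwoPi τ * expTwoPi z) *
      qPochhammerInf (expTwoPi τ) (expTwoPi τ * expTwoPi (-z)))) * h2

lemma iff_add_int_mul {p : ℂ → Prop} {w : ℂ} (hp : ∀ z, p (z + w) ↔ p z) (n : ℤ) (z : ℂ) :
    p (z + n * w) ↔ p z := by
  induction n with
  | zero => simp
  | succ n ih =>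
    rw [← ih, ← hp (z + ((n : ℕ) : ℤ) * w)]
    push_cast
    ring_nf
  | pred n ih =>
    rw [← ih, ← hp]
    push_cast
    ring_nf

/-- A property invariant under translation by `τ` holds everywhere once it holds on the
strip `0 ≤ im z < im τ`. -/
lemma forall_of_strip {τ : ℂ} (hτ : 0 < τ.im) {p : ℂ → Prop} (hp : ∀ z, p (z + τ) ↔ p z)
    (hs : ∀ z : ℂ, 0 ≤ z.im → z.im < τ.im → p z) (z : ℂ) : p z := by
  rw [← iff_add_int_mul hp (-⌊z.im / τ.im⌋) z]
  have h1 := Int.floor_le (z.im / τ.im)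
  have h2 := Int.lt_floor_add_one (z.im / τ.im)
  rw [le_div_iff₀ hτ] at h1
  rw [div_lt_iff₀ hτ] at h2
  apply hs <;> simp <;> linarith

lemma thetaProd_eq_zero_imp {τ : ℂ} (hτ : 0 < τ.im) (z : ℂ) (hz : thetaProd τ z = 0) :
    (∃ n k : ℤ, z = n + k * τ) ∧ deriv (thetaProd τ) z ≠ 0 := by
  revert z
  refine forall_of_strip hτ (fun z ↦ ?_) fun z h0 h1 hz ↦ ?_
  · have hu : -expTwoPi (-z) ≠ 0 := neg_ne_zero.2 (expTwoPi_ne_zero _)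
    have hz : thetaProd τ (z + τ) = 0 ↔ thetaProd τ z = 0 := by
      rw [thetaProd_add_tau hτ, mul_eq_zero, or_iff_right hu]
    have hl : (∃ n k : ℤ, z + τ = n + k * τ) ↔ ∃ n k : ℤ, z = n + k * τ := by
      constructor
      · rintro ⟨n, k, h⟩
        exact ⟨n, k - 1, by push_cast; linear_combination h⟩
      · rintro ⟨n, k, h⟩
        exact ⟨n, k + 1, by push_cast; linear_combination h⟩
    rw [hz, hl]
    refine imp_congr_right fun h ↦ and_congr_right fun _ ↦ ?_
    have hd : deriv (thetaProd τ) (z + τ) = -expTwoPi (-z) * deriv (thetaProd τ) z := by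
      have hd1 : HasDerivAt (fun z ↦ -expTwoPi (-z)) _ z :=
        (differentiable_expTwoPi.comp differentiable_neg).neg.differentiableAt.hasDerivAt
      rw [← deriv_comp_add_const, funext (thetaProd_add_tau hτ),
        (hd1.fun_mul (differentiable_thetaProd hτ z).hasDerivAt).deriv, h, mul_zero, zero_add]
    rw [hd, mul_ne_zero_iff, and_iff_right hu]
  · set g : ℂ → ℂ := fun z ↦ qPochhammerInf (expTwoPi τ) (expTwoPi τ * expTwoPi z) *
      qPochhammerInf (expTwoPi τ) (expTwoPi τ * expTwoPi (-z)) with hg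
    have hq := norm_expTwoPi_lt_one hτ
    have hgz : g z ≠ 0 := by
      apply mul_ne_zero <;> apply qPochhammerInf_ne_zero hq <;> rw [← expTwoPi_add] <;>
        apply norm_expTwoPi_lt_one <;> simp <;> linarith
    have hgd : Differentiable ℂ g := by
      have h := differentiable_qPochhammerInf hq
      have he := differentiable_expTwoPi
      exact (h.comp (he.const_mul _)).mul (h.comp ((he.comp differentiable_neg).const_mul _))
    have he : expTwoPi z = 1 := by
      rw [thetaProd_eq_one_sub_mul hτ, mul_eq_zero, or_iff_left hgz] at hz
      linear_combination -hz
    refine ⟨?_, ?_⟩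
    · obtain ⟨n, hn⟩ := (expTwoPi_eq_one_iff z).1 he
      exact ⟨n, 0, by simpa using hn⟩
    · have hd : HasDerivAt expTwoPi (2 * Real.pi * Complex.I) z := by
        have := ((hasDerivAt_id z).const_mul (2 * Real.pi * Complex.I : ℂ)).cexp
        simp only [id, mul_one] at this
        have h2 : Complex.exp (2 * Real.pi * Complex.I * z) = 1 := he
        rwa [h2, one_mul] at this
      rw [funext (thetaProd_eq_one_sub_mul hτ)]
      have := (hd.const_sub 1).fun_mul (hgd z).hasDerivAt
      rw [he, sub_self, zero_mul, add_zero] at this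
      rw [this.deriv]
      exact mul_ne_zero (neg_ne_zero.2 Complex.two_pi_I_ne_zero) hgz

/-- An entire function vanishing at the zeros of an entire function `θ` with only simple zeros is
divisible by `θ`. -/
lemma exists_eq_mul_of_simple_zeros {θ f : ℂ → ℂ} (hθ : Differentiable ℂ θ)
    (hf : Differentiable ℂ f) (hθf : ∀ z, θ z = 0 → deriv θ z ≠ 0 ∧ f z = 0) :
    ∃ h : ℂ → ℂ, Differentiable ℂ h ∧ ∀ z, f z = θ z * h z := by
  classical
  refine ⟨fun z ↦ if θ z = 0 then deriv f z / deriv θ z else f z / θ z, fun c ↦ ?_, fun z ↦ ?_⟩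
  · by_cases hc : θ c = 0
    · have hdθ : Differentiable ℂ (dslope θ c) := by
        rw [← differentiableOn_univ, Complex.differentiableOn_dslope univ_mem]
        exact hθ.differentiableOn
      have hdf : Differentiable ℂ (dslope f c) := by
        rw [← differentiableOn_univ, Complex.differentiableOn_dslope univ_mem]
        exact hf.differentiableOn
      obtain ⟨hd, hfc⟩ := hθf c hc
      have hne : dslope θ c c ≠ 0 := by rwa [dslope_same]
      refine ((hdf c).fun_div (hdθ c) hne).congr_of_eventuallyEq ?_
      filter_upwards [(hdθ c).continuousAt.eventually_ne hne] with z hz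
      by_cases hzc : z = c
      · subst hzc
        simp [hc]
      · rw [dslope_of_ne _ hzc, slope_def_field, hc, sub_zero] at hz
        have hzc' : z - c ≠ 0 := sub_ne_zero.2 hzc
        have hθz : θ z ≠ 0 := fun h ↦ hz (by rw [h, zero_div])
        rw [if_neg hθz, dslope_of_ne _ hzc, dslope_of_ne _ hzc, slope_def_field, slope_def_field, hfc,
          hc, sub_zero, sub_zero]
        field_simp
    · refine ((hf c).fun_div (hθ c) hc).congr_of_eventuallyEq ?_
      filter_upwards [(hθ c).continuousAt.eventually_ne hc] with z hz
      rw [if_neg hz]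
  · by_cases hz : θ z = 0
    · simp [hz, (hθf z hz).2]
    · simp only [if_neg hz]
      field_simp

lemma eq_of_mul_eq_mul_of_differentiable {θ g h : ℂ → ℂ} (hθ : Differentiable ℂ θ)
    (hg : Differentiable ℂ g) (hh : Differentiable ℂ h) (hθ0 : θ ≠ 0)
    (H : ∀ z, θ z * g z = θ z * h z) : g = h := by
  have hθ' : AnalyticOnNhd ℂ θ Set.univ := fun z _ ↦ hθ.analyticAt z
  have hgh : AnalyticOnNhd ℂ (fun z ↦ g z - h z) Set.univ := fun z _ ↦ (hg.sub hh).analyticAt z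
  rcases hθ'.eq_zero_or_eq_zero_of_mul_eq_zero hgh (fun z _ ↦ by simp [mul_sub, H])
    isPreconnected_univ with h1 | h1
  · exact absurd (funext fun z ↦ h1 z trivial) hθ0
  · exact funext fun z ↦ sub_eq_zero.1 (h1 z trivial)

/-- A continuous function with periods `1` and `τ` is bounded above. -/
lemma exists_forall_le_of_doubly_periodic {τ : ℂ} (hτ : 0 < τ.im) {G : ℂ → ℝ}
    (hG : Continuous G) (h1 : ∀ z, G (z + 1) = G z) (h2 : ∀ z, G (z + τ) = G z) :
    ∃ B, ∀ z, G z ≤ B := by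
  obtain ⟨B, hB⟩ := ((isCompact_Icc (a := (0 : ℝ)) (b := 1)).reProdIm
    (isCompact_Icc (a := (0 : ℝ)) (b := τ.im))).bddAbove_image hG.continuousOn
  refine ⟨B, forall_of_strip hτ (fun z ↦ by rw [h2]) fun z hz0 hz1 ↦ ?_⟩
  rw [← iff_add_int_mul (p := fun z ↦ G z ≤ B) (w := 1) (fun z ↦ by rw [h1]) (-⌊z.re⌋) z]
  refine hB ⟨_, Complex.mem_reProdIm.2 ⟨⟨?_, ?_⟩, ⟨?_, ?_⟩⟩, rfl⟩
  · simpa using Int.floor_le z.re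
  · simpa using by linarith [Int.lt_floor_add_one z.re]
  · simpa using hz0
  · simpa using hz1.le

/-- There are no nonzero theta functions of negative order. -/
lemma eq_zero_of_quasiperiodic_of_neg {τ : ℂ} (hτ : 0 < τ.im) {N : ℤ} (hN : N < 0) {C : ℂ}
    {f : ℂ → ℂ} (hf : Differentiable ℂ f) (h1 : ∀ z, f (z + 1) = f z)
    (h2 : ∀ z, f (z + τ) = C * expTwoPi (-(N * z)) * f z) : f = 0 := by
  by_cases hC : C = 0
  · funext z
    have := h2 (z - τ)
    simpa [hC] using this
  have hpi := Real.pi_pos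
  set α : ℝ := -(Real.pi * N / τ.im) with hα
  have hα0 : 0 < α := by
    have : (N : ℝ) < 0 := by exact_mod_cast hN
    rw [hα, ← neg_div, ← mul_neg]
    have : (0 : ℝ) < -N := by linarith
    positivity
  set b : ℝ := -(Real.log ‖C‖ / τ.im + α * τ.im) with hb
  obtain ⟨B, hB⟩ := exists_forall_le_of_doubly_periodic hτ
    (G := fun z ↦ ‖f z‖ * Real.exp (z.im * (α * z.im + b)))
    (hf.continuous.norm.mul (Real.continuous_exp.comp
      (Complex.continuous_im.mul ((continuous_const.mul Complex.continuous_im).add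
        continuous_const)))) (fun z ↦ by simp [h1]) (fun z ↦ by
      rw [h2, norm_mul, norm_mul, norm_expTwoPi, ← Real.exp_log (norm_pos_iff.2 hC)]
      rw [← Real.exp_add, mul_right_comm, ← Real.exp_add, mul_comm]
      congr 2
      have hτ' := hτ.ne'
      simp only [Complex.add_im, Complex.neg_im, Complex.mul_im, Complex.intCast_re,
        Complex.intCast_im, zero_mul, add_zero, hb, hα]
      field_simp
      ring)
  have hlim : Tendsto (fun y : ℝ ↦ y * (α * y + b)) atTop atTop :=
    tendsto_id.atTop_mul_atTop₀ (tendsto_atTop_add_const_right _ _ (tendsto_id.const_mul_atTop hα0))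
  have hle : ∀ z, ‖f z‖ ≤ B * Real.exp (-(z.im * (α * z.im + b))) := fun z ↦ by
    rw [Real.exp_neg, ← div_eq_mul_inv, le_div_iff₀ (Real.exp_pos _)]
    exact hB z
  have hB0 : 0 ≤ B := (by positivity : (0 : ℝ) ≤ _).trans (hB 0)
  have hbdd : Bornology.IsBounded (Set.range f) := by
    refine (Metric.isBounded_closedBall (x := (0 : ℂ))
      (r := B * Real.exp (b ^ 2 / (4 * α)))).subset ?_
    rintro _ ⟨z, rfl⟩
    rw [mem_closedBall_zero_iff]
    refine (hle z).trans ?_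
    gcongr
    rw [le_div_iff₀ (by positivity)]
    nlinarith [sq_nonneg (2 * α * z.im + b)]
  have h0 : ∀ y : ℝ, ‖f 0‖ ≤ B * Real.exp (-(y * (α * y + b))) := fun y ↦ by
    rw [hf.apply_eq_apply_of_bounded hbdd 0 (y * Complex.I)]
    simpa using hle (y * Complex.I)
  have hf0 : ‖f 0‖ ≤ 0 := by
    refine ge_of_tendsto' (x := atTop) ?_ h0
    simpa using ((Real.tendsto_exp_neg_atTop_nhds_zero.comp hlim).const_mul B)
  funext z
  rw [hf.apply_eq_apply_of_bounded hbdd z 0]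
  simpa using hf0

/-- A theta function of order `N` with more than `N` zeros modulo the lattice vanishes. -/
lemma eq_zero_of_quasiperiodic_of_zeros {ι : Type*} {τ : ℂ} (hτ : 0 < τ.im) (a : ι → ℂ)
    (ha : ∀ i j, i ≠ j → ∀ n k : ℤ, a i - a j ≠ n + k * τ) (s : Finset ι) :
    ∀ {N : ℤ}, N < s.card → ∀ {C : ℂ} {f : ℂ → ℂ}, Differentiable ℂ f →
      (∀ z, f (z + 1) = f z) → (∀ z, f (z + τ) = C * expTwoPi (-(N * z)) * f z) →
      (∀ i ∈ s, f (a i) = 0) → f = 0 := by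
  classical
  induction s using Finset.induction_on with
  | empty =>
    exact fun hN _ _ hf h1 h2 _ ↦
      eq_zero_of_quasiperiodic_of_neg hτ (by simpa using hN) hf h1 h2
  | insert i s his ih =>
    intro N hN C f hf h1 h2 hz
    by_cases hC : C = 0
    · funext z
      have := h2 (z - τ)
      simpa [hC] using this
    have hθ := differentiable_thetaProd hτ
    set t : ℂ → ℂ := fun z ↦ thetaProd τ (z - a i) with ht
    have htd : Differentiable ℂ t := hθ.comp (differentiable_id.sub_const _)
    have hzeros : ∀ n k : ℤ, f (a i + (n + k * τ)) = 0 := fun n k ↦ by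
      rw [← add_assoc]
      refine (iff_add_int_mul (p := fun z ↦ f z = 0) (fun z ↦ ?_) k _).2 ?_
      · simp [h2, hC, expTwoPi_ne_zero]
      · rw [← mul_one (n : ℂ)]
        exact (iff_add_int_mul (p := fun z ↦ f z = 0) (fun z ↦ by rw [h1]) n _).2
          (hz i (Finset.mem_insert_self i s))
    have htz : ∀ z, t z = 0 → (∃ n k : ℤ, z - a i = n + k * τ) ∧ deriv t z ≠ 0 := fun z hz ↦ by
      rw [ht, deriv_comp_sub_const]
      exact thetaProd_eq_zero_imp hτ _ hz
    obtain ⟨h, hh, hfh⟩ := exists_eq_mul_of_simple_zeros htd hf fun z hz ↦ by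
      obtain ⟨⟨n, k, hnk⟩, hd⟩ := htz z hz
      refine ⟨hd, ?_⟩
      rw [← hzeros n k, ← hnk]
      congr 1
      ring
    have ht0 : t ≠ 0 := fun h0 ↦ by
      have := (htz 0 (congrFun h0 0)).2
      rw [h0] at this
      simp at this
    have ht1 : ∀ z, t (z + 1) = t z := fun z ↦ by
      rw [ht]
      simp only
      rw [← thetaProd_add_one τ (z - a i)]
      congr 1
      ring
    have ht2 : ∀ z, t (z + τ) = -(expTwoPi (a i) * expTwoPi (-z)) * t z := fun z ↦ by
      rw [ht]
      simp only
      rw [← expTwoPi_add, show a i + -z = -(z - a i) by ring, ← thetaProd_add_tau hτ]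
      congr 1
      ring
    have hh0 : h = 0 := by
      refine ih (N := N - 1) (C := -(C * expTwoPi (-a i))) ?_ hh ?_ ?_ ?_
      · rw [Finset.card_insert_of_notMem his] at hN
        push_cast at hN
        linarith
      · refine congrFun (eq_of_mul_eq_mul_of_differentiable htd
          (hh.comp (differentiable_id.add_const 1)) hh ht0 fun z ↦ ?_)
        rw [← hfh, ← h1, hfh, ht1]
      · refine congrFun (eq_of_mul_eq_mul_of_differentiable htd
          (hh.comp (differentiable_id.add_const τ))
          (((differentiable_expTwoPi.comp
            (differentiable_id.const_mul _).neg).const_mul _).mul hh) ht0 fun z ↦ ?_)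
        have h3 := h2 z
        rw [hfh, hfh, ht2] at h3
        have h4 : expTwoPi (-((N - 1 : ℤ) * z)) = expTwoPi (-(N * z)) * expTwoPi z := by
          rw [← expTwoPi_add]; push_cast; congr 1; ring
        rw [h4, expTwoPi_neg (a i)]
        rw [expTwoPi_neg z] at h3
        have e1 := expTwoPi_ne_zero z
        have e2 := expTwoPi_ne_zero (a i)
        field_simp at h3 ⊢
        linear_combination -h3
      · intro j hj
        have h5 := hz j (Finset.mem_insert_of_mem hj)
        rw [hfh, mul_eq_zero] at h5
        refine h5.resolve_left fun h6 ↦ ?_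
        obtain ⟨⟨n, k, hnk⟩, -⟩ := htz _ h6
        exact ha j i (fun hji ↦ his (hji ▸ hj)) n k hnk
    funext z
    simp [hfh, hh0]

lemma im_div_ne_zero_of_linearIndependent {ω1 ω2 : ℂ}
    (hind : LinearIndependent ℝ ![ω1, ω2]) : ω1 ≠ 0 ∧ (ω2 / ω1).im ≠ 0 := by
  rw [LinearIndependent.pair_iff] at hind
  have h1 : ω1 ≠ 0 := fun h ↦ by simpa using (hind 1 0 (by simp [h])).1
  refine ⟨h1, fun h ↦ ?_⟩
  have h2 : ω2 = ((ω2 / ω1).re : ℂ) * ω1 := by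
    rw [show (((ω2 / ω1).re : ℝ) : ℂ) = ω2 / ω1 from Complex.ext (by simp) (by simp [h])]
    field_simp
  have := (hind (-(ω2 / ω1).re) 1 (by
    rw [Complex.real_smul, Complex.real_smul, Complex.ofReal_neg, Complex.ofReal_one]
    linear_combination h2)).2
  simp at this

/-- A theta function of order `2m` for the period lattice `2Γ` with more than `2m` zeros modulo
`2Γ` vanishes. -/
lemma eq_zero_of_theta_order_two_mul {ι : Type*} [Fintype ι] {ω1 ω2 η1 η2 : ℂ}
    (hind : LinearIndependent ℝ ![ω1, ω2])
    (hleg : η1 * ω2 - η2 * ω1 = (Real.pi : ℂ) * Complex.I / 2) {m : ℕ} {Φ : ℂ → ℂ}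
    (hΦ : Differentiable ℂ Φ)
    (h1 : ∀ z, Φ (z + 2 * ω1) = Complex.exp (4 * m * η1 * (z + ω1)) * Φ z)
    (h2 : ∀ z, Φ (z + 2 * ω2) = Complex.exp (4 * m * η2 * (z + ω2)) * Φ z)
    (b : ι → ℂ) (hb0 : ∀ i, Φ (b i) = 0)
    (hb : ∀ i j, i ≠ j → ∀ n k : ℤ, b i - b j ≠ 2 * (n * ω1 + k * ω2))
    (hcard : 2 * m < Fintype.card ι) : Φ = 0 := by
  obtain ⟨hω1, him⟩ := im_div_ne_zero_of_linearIndependent hind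
  set τ := ω2 / ω1 with hτ
  have hω2 : ω2 = τ * ω1 := by rw [hτ]; field_simp
  set f : ℂ → ℂ := fun u ↦ Complex.exp (-(4 * m * η1 * ω1 * u ^ 2)) * Φ (2 * ω1 * u) with hf
  have hfd : Differentiable ℂ f :=
    Differentiable.mul (by fun_prop) (hΦ.comp (differentiable_id.const_mul _))
  have hf1 : ∀ u, f (u + 1) = f u := fun u ↦ by
    simp only [hf]
    rw [show 2 * ω1 * (u + 1) = 2 * ω1 * u + 2 * ω1 by ring, h1, ← mul_assoc, ← Complex.exp_add]
    congr 2
    ring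
  set C : ℂ := Complex.exp (4 * m * (η2 - η1 * τ) * ω2)
  have hf2 : ∀ u, f (u + τ) = C * expTwoPi (-((2 * m : ℤ) * u)) * f u := fun u ↦ by
    simp only [hf, C, expTwoPi]
    rw [show 2 * ω1 * (u + τ) = 2 * ω1 * u + 2 * ω2 by rw [hω2]; ring, h2, ← mul_assoc,
      ← mul_assoc, ← Complex.exp_add, ← Complex.exp_add, ← Complex.exp_add]
    congr 2
    push_cast
    rw [hω2] at hleg ⊢
    linear_combination (-8 * m * u) * hleg
  have hne : 2 * ω1 ≠ 0 := mul_ne_zero two_ne_zero hω1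
  set a : ι → ℂ := fun i ↦ b i / (2 * ω1) with ha
  have ha0 : ∀ i, f (a i) = 0 := fun i ↦ by
    simp only [hf, ha]
    rw [mul_div_cancel₀ _ hne, hb0, mul_zero]
  have hab : ∀ i j, i ≠ j → ∀ n k : ℤ, a i - a j ≠ n + k * τ := fun i j hij n k h ↦ by
    refine hb i j hij n k ?_
    simp only [ha] at h
    rw [← sub_div, div_eq_iff hne] at h
    rw [h, hω2]
    ring
  have hf0 : f = 0 := by
    rcases lt_or_gt_of_ne him with hneg | hpos
    · refine eq_zero_of_quasiperiodic_of_zeros (τ := -τ) (by simpa using hneg) a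
        (fun i j hij n k h ↦ hab i j hij n (-k) (by rw [h]; push_cast; ring)) Finset.univ
        (N := -(2 * m)) (C := C⁻¹ * expTwoPi (-(2 * m * τ))) ?_ hfd hf1 (fun z ↦ ?_)
        fun i _ ↦ ha0 i
      · rw [Finset.card_univ]
        omega
      · have h := hf2 (z + -τ)
        rw [neg_add_cancel_right] at h
        have e : expTwoPi (-(2 * m * τ)) * expTwoPi (-((-(2 * m) : ℤ) * z)) *
            expTwoPi (-((2 * m : ℤ) * (z + -τ))) = 1 := by
          rw [← expTwoPi_add, ← expTwoPi_add, expTwoPi_eq_one_iff]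
          exact ⟨0, by push_cast; ring⟩
        have hC : C⁻¹ * C = 1 := inv_mul_cancel₀ (Complex.exp_ne_zero _)
        rw [h]
        linear_combination (-f (z + -τ)) * e - f (z + -τ) * (expTwoPi (-(2 * m * τ)) *
          expTwoPi (-((-(2 * m) : ℤ) * z)) * expTwoPi (-((2 * m : ℤ) * (z + -τ)))) * hC
    · refine eq_zero_of_quasiperiodic_of_zeros hpos a hab Finset.univ (N := 2 * m) ?_ hfd hf1 hf2
        fun i _ ↦ ha0 i
      rw [Finset.card_univ]
      exact_mod_cast hcard
  funext z
  have h := congrFun hf0 (z / (2 * ω1))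
  simp only [hf, mul_div_cancel₀ _ hne, Pi.zero_apply, mul_eq_zero, Complex.exp_ne_zero,
    false_or] at h
  exact h

/-- The multiplier of the antisymmetrization `ψt z * ψ (-z) - ψt (-z) * ψ z` under a common
quasi-period of `ψ` and `ψt`. -/
lemma antisymmetrization_add_period {ψ ψt : ℂ → ℂ} {c η α w : ℂ}
    (h : ∀ z, ψ (z + 2 * w) = Complex.exp (2 * c * η * z + α) * ψ z)
    (ht : ∀ z, ψt (z + 2 * w) = Complex.exp (2 * c * η * z + α) * ψt z) (z : ℂ) :
    ψt (z + 2 * w) * ψ (-(z + 2 * w)) - ψt (-(z + 2 * w)) * ψ (z + 2 * w) =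
      Complex.exp (4 * c * η * (z + w)) * (ψt z * ψ (-z) - ψt (-z) * ψ z) := by
  have h1 := h (-(z + 2 * w))
  have h2 := ht (-(z + 2 * w))
  rw [show -(z + 2 * w) + 2 * w = -z by ring] at h1 h2
  have e : Complex.exp (2 * c * η * z + α) = Complex.exp (4 * c * η * (z + w)) *
      Complex.exp (2 * c * η * (-(z + 2 * w)) + α) := by
    rw [← Complex.exp_add]
    congr 1
    ring
  rw [h, ht, h1, h2, e]
  ring

/-- If `ψ` and `ψt` have common multipliers for the translation by `2w`, and satisfy the same
linear relation between their values at `w + a` and `w - a`, then the antisymmetrization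
`ψt z * ψ (-z) - ψt (-z) * ψ z` vanishes at `w ± a`. -/
lemma antisymmetrization_eq_zero {ψ ψt : ℂ → ℂ} {w a E : ℂ}
    (hw : ∀ z, ∃ c ≠ 0, ψ (z + 2 * w) = c * ψ z ∧ ψt (z + 2 * w) = c * ψt z)
    (h : ψ (w + a) = ψ (w - a) * E) (ht : ψt (w + a) = ψt (w - a) * E) :
    ψt (w + a) * ψ (-(w + a)) - ψt (-(w + a)) * ψ (w + a) = 0 ∧
      ψt (w - a) * ψ (-(w - a)) - ψt (-(w - a)) * ψ (w - a) = 0 := by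
  obtain ⟨c, -, h1, h2⟩ := hw (-(w + a))
  obtain ⟨d, hd, h3, h4⟩ := hw (-(w - a))
  rw [show -(w + a) + 2 * w = w - a by ring] at h1 h2
  rw [show -(w - a) + 2 * w = w + a by ring] at h3 h4
  constructor
  · rw [h, ht, h1, h2]; ring
  · refine (mul_eq_zero.1 ?_).resolve_left hd
    rw [h] at h3
    rw [ht] at h4
    linear_combination ψ (w - a) * h4 - ψt (w - a) * h3

/-- Coordinates `(s, k)` of the points `ω s + k * γ`: the points at which the conditions defining
`Q` are imposed around the half-periods `ω s`, together with the origin. -/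
def betheIndex {mi mi' : Fin 4 → ℕ} :
    Option (Σ s : Fin 4, (Fin (mi s) ⊕ Fin (mi' s)) × Bool) → Fin 4 × ℤ
  | none => (0, 0)
  | some ⟨s, .inl j, true⟩ => (s, 2 * (j + 1))
  | some ⟨s, .inl j, false⟩ => (s, -(2 * (j + 1)))
  | some ⟨s, .inr j, true⟩ => (s, 2 * (j + 1) - 1)
  | some ⟨s, .inr j, false⟩ => (s, -(2 * (j + 1) - 1))

lemma betheIndex_injective {mi mi' : Fin 4 → ℕ} :
    Function.Injective (betheIndex (mi := mi) (mi' := mi')) := by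
  rintro (_ | ⟨s, j | j, _ | _⟩) (_ | ⟨t, k | k, _ | _⟩) h <;>
    simp only [betheIndex, Prod.mk.injEq] at h <;>
    first
    | rfl
    | (exfalso; omega)
    | (obtain ⟨rfl, h⟩ := h
       have hjk : j = k := by omega
       rw [hjk])

lemma card_betheIndex (mi mi' : Fin 4 → ℕ) :
    Fintype.card (Option (Σ s : Fin 4, (Fin (mi s) ⊕ Fin (mi' s)) × Bool)) =
      2 * ∑ s, (mi s + mi' s) + 1 := by
  simp [Finset.mul_sum, mul_comm]

lemma eq_of_halfPeriod_add_mul_congr {ω1 ω2 : ℂ} (hind : LinearIndependent ℝ ![ω1, ω2])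
    {ω : Fin 4 → ℂ} (hω : ω = ![0, ω1, ω2, -ω1 - ω2])
    {γ : ℂ} (hγ : ¬∃ q1 q2 : ℚ, γ = (q1 : ℂ) * ω1 + (q2 : ℂ) * ω2) {x y : Fin 4 × ℤ} {n l : ℤ}
    (h : (ω x.1 + x.2 * γ) - (ω y.1 + y.2 * γ) = 2 * (n * ω1 + l * ω2)) : x = y := by
  obtain ⟨s, k⟩ := x
  obtain ⟨t, k'⟩ := y
  set p : Fin 4 → ℤ := ![0, 1, 0, -1] with hp
  set q : Fin 4 → ℤ := ![0, 0, 1, -1] with hq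
  have hpq : ∀ s, ω s = p s * ω1 + q s * ω2 := fun s ↦ by
    fin_cases s <;> simp [hω, hp, hq, sub_eq_add_neg]
  simp only [hpq] at h
  have hk : k = k' := by
    by_contra hk
    have hkC : (k : ℂ) - k' ≠ 0 := sub_ne_zero.2 (by exact_mod_cast hk)
    refine hγ ⟨(2 * n - p s + p t) / (k - k'), (2 * l - q s + q t) / (k - k'), ?_⟩
    push_cast
    field_simp
    linear_combination h
  subst hk
  have hst := LinearIndependent.pair_iff.1 hind (p s - p t - 2 * n : ℤ) (q s - q t - 2 * l : ℤ) (by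
    rw [Complex.real_smul, Complex.real_smul]
    push_cast
    linear_combination h)
  have h1 : p s - p t - 2 * n = 0 := by exact_mod_cast hst.1
  have h2 : q s - q t - 2 * l = 0 := by exact_mod_cast hst.2
  have : s = t := by
    clear_value p q
    subst hp hq
    fin_cases s <;> fin_cases t <;> simp at h1 h2 ⊢ <;> omega
  rw [this]

/-- **Lemma (Chalykh).** For any two entire functions `ψ, ψ̃ ∈ F^{α₁,α₂}_m ∩ Q` (with `ψ`
not identically zero) the quotient `ψ̃/ψ` is an even elliptic function; equivalently,
`ψ̃(z)·ψ(-z) = ψ̃(-z)·ψ(z)` for all `z`. -/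
theorem quotient_of_Q_theta_functions_is_even
    -- the period lattice
    (ω1 ω2 : ℂ) (hind : LinearIndependent ℝ ![ω1, ω2])
    (η1 η2 : ℂ) (hleg : η1 * ω2 - η2 * ω1 = (Real.pi : ℂ) * Complex.I / 2)
    (ω : Fin 4 → ℂ) (hω : ω = ![0, ω1, ω2, -ω1 - ω2])
    (η : Fin 4 → ℂ) (hη : η = ![0, η1, η2, -η1 - η2])
    -- the step γ and the integer coupling parameters
    (γ : ℂ) (hγ : ¬∃ q1 q2 : ℚ, γ = (q1 : ℂ) * ω1 + (q2 : ℂ) * ω2)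
    (mi mi' : Fin 4 → ℕ)
    (m : ℕ) (hm : m = ∑ p : Fin 4, (mi p + mi' p)) (hm1 : 1 ≤ m)
    -- two members ψ, ψ̃ of F^{α₁,α₂}_m ∩ Q, with ψ not identically zero
    (α1 α2 : ℂ) (ψ ψt : ℂ → ℂ)
    (hψF1 : ∀ z, ψ (z + 2 * ω1) = Complex.exp (2 * (m : ℂ) * η1 * z + α1) * ψ z)
    (hψF2 : ∀ z, ψ (z + 2 * ω2) = Complex.exp (2 * (m : ℂ) * η2 * z + α2) * ψ z)
    (hψtF1 : ∀ z, ψt (z + 2 * ω1) = Complex.exp (2 * (m : ℂ) * η1 * z + α1) * ψt z)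
    (hψtF2 : ∀ z, ψt (z + 2 * ω2) = Complex.exp (2 * (m : ℂ) * η2 * z + α2) * ψt z)
    (hψQ : memQ ω η ω1 ω2 η1 η2 γ m mi mi' ψ)
    (hψtQ : memQ ω η ω1 ω2 η1 η2 γ m mi mi' ψt)
    (hψ0 : ψ ≠ 0) :
    ∀ z : ℂ, ψt z * ψ (-z) = ψt (-z) * ψ z := by
  set φ : ℂ → ℂ := fun z ↦ ψt z * ψ (-z) - ψt (-z) * ψ z with hφ
  have hw1 : ∀ z, ∃ c ≠ 0, ψ (z + 2 * ω1) = c * ψ z ∧ ψt (z + 2 * ω1) = c * ψt z :=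
    fun z ↦ ⟨_, Complex.exp_ne_zero _, hψF1 z, hψtF1 z⟩
  have hw2 : ∀ z, ∃ c ≠ 0, ψ (z + 2 * ω2) = c * ψ z ∧ ψt (z + 2 * ω2) = c * ψt z :=
    fun z ↦ ⟨_, Complex.exp_ne_zero _, hψF2 z, hψtF2 z⟩
  have hw3 : ∀ z, ∃ c ≠ 0, ψ (z + 2 * (-ω1 - ω2)) = c * ψ z ∧
      ψt (z + 2 * (-ω1 - ω2)) = c * ψt z := fun z ↦ by
    obtain ⟨c, hc, h1, h2⟩ := hw1 (z + 2 * (-ω1 - ω2))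
    obtain ⟨d, hd, h3, h4⟩ := hw2 (z + 2 * (-ω1 - ω2) + 2 * ω1)
    rw [show z + 2 * (-ω1 - ω2) + 2 * ω1 + 2 * ω2 = z by ring] at h3 h4
    refine ⟨(d * c)⁻¹, inv_ne_zero (mul_ne_zero hd hc), ?_, ?_⟩
    · rw [h3, h1]; field_simp
    · rw [h4, h2]; field_simp
  have hw : ∀ s z, ∃ c ≠ 0, ψ (z + 2 * ω s) = c * ψ z ∧ ψt (z + 2 * ω s) = c * ψt z := by
    intro s
    subst hω
    fin_cases s
    · exact fun z ↦ ⟨1, one_ne_zero, by simp, by simp⟩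
    · exact hw1
    · exact hw2
    · exact hw3
  obtain ⟨hψd, hψQ⟩ := hψQ
  obtain ⟨hψtd, hψtQ⟩ := hψtQ
  have hzero1 : ∀ s, ∀ j : Fin (mi s), φ (ω s + 2 * ((j : ℕ) + 1) * γ) = 0 ∧
      φ (ω s - 2 * ((j : ℕ) + 1) * γ) = 0 := fun s j ↦ by
    have h := (hψQ s 0 0).1 (j + 1) (by omega) (by omega)
    have ht := (hψtQ s 0 0).1 (j + 1) (by omega) (by omega)
    simp only [Int.cast_zero, zero_mul, add_zero, mul_zero, Nat.cast_add, Nat.cast_one] at h ht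
    exact antisymmetrization_eq_zero (hw s) h ht
  have hzero2 : ∀ s, ∀ j : Fin (mi' s), φ (ω s + (2 * ((j : ℕ) + 1) - 1) * γ) = 0 ∧
      φ (ω s - (2 * ((j : ℕ) + 1) - 1) * γ) = 0 := fun s j ↦ by
    have h := (hψQ s 0 0).2 (j + 1) (by omega) (by omega)
    have ht := (hψtQ s 0 0).2 (j + 1) (by omega) (by omega)
    simp only [Int.cast_zero, zero_mul, add_zero, mul_zero, Nat.cast_add, Nat.cast_one] at h ht
    exact antisymmetrization_eq_zero (hw s) h ht
  have hφ0 : φ = 0 := by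
    refine eq_zero_of_theta_order_two_mul hind hleg (m := m)
      ((hψtd.mul (hψd.comp differentiable_neg)).sub ((hψtd.comp differentiable_neg).mul hψd))
      (antisymmetrization_add_period hψF1 hψtF1) (antisymmetrization_add_period hψF2 hψtF2)
      (fun i : Option (Σ s : Fin 4, (Fin (mi s) ⊕ Fin (mi' s)) × Bool) ↦
        ω (betheIndex i).1 + (betheIndex i).2 * γ) ?_ ?_ ?_
    · rintro (_ | ⟨s, j | j, _ | _⟩)
      · simp [betheIndex, hω, hφ]
      · convert (hzero1 s j).2 using 2
        simp [betheIndex, sub_eq_add_neg]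
      · convert (hzero1 s j).1 using 2
        simp [betheIndex]
      · convert (hzero2 s j).2 using 2
        simp only [betheIndex]
        push_cast
        ring
      · convert (hzero2 s j).1 using 2
        simp [betheIndex]
    · exact fun i j hij n l h ↦
        hij (betheIndex_injective (eq_of_halfPeriod_add_mul_congr hind hω hγ h))
    · rw [card_betheIndex, ← hm]
      omega
  intro z
  have := congrFun hφ0 z
  simp only [hφ, Pi.zero_apply] at this
  exact sub_eq_zero.1 this
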